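/- The Yang–Mills kinematic complex carries a second differential b of degree −1 realizing the defining relations of the BV□ structure: (i) m₁∘m₁ = 0, i.e. m₁(m₁λ) = 0 in K₂ and m₁(m₁(A,φ)) = 0 in K₃; (ii) b∘b = 0, i.e. b(b(E,e)) = 0 and b(b(N)) = 0; (iii) m₁b + bm₁ = □, i.e. m₁(bλ) + b(m₁λ) = □λ, m₁(b(A,φ)) + b(m₁(A,φ)) = (□A, □φ), m₁(b(E,e)) + b(m₁(E,e)) = (□E, □e), and m₁(bN) + b(m₁N) = □N. -/

import Mathlib

noncomputable section

/-- Points of ℝ^D. -/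
abbrev Pt (D : ℕ) := Fin D → ℝ
/-- Scalar fields on ℝ^D. -/
abbrev Fn (D : ℕ) := Pt D → ℝ
/-- Vector fields on ℝ^D (components carry a lower Lorentz index). -/
abbrev Vec (D : ℕ) := Pt D → Fin D → ℝ

/-- Diagonal entries of the Minkowski metric η = diag(−1,1,…,1) (η is its own inverse). -/
def eta (D : ℕ) (μ : Fin D) : ℝ := if (μ : ℕ) = 0 then -1 else 1

/-- Partial derivative ∂_μ. -/
def pd {D : ℕ} (μ : Fin D) (f : Fn D) : Fn D := fun x => fderiv ℝ f x (Pi.single μ 1)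

/-- Minkowski pairing X·Y = η^{μν} X_μ Y_ν. -/
def dot {D : ℕ} (X Y : Vec D) : Fn D := fun x => ∑ μ, eta D μ * X x μ * Y x μ

/-- Divergence ∂·X = ∂^μ X_μ. -/
def divg {D : ℕ} (X : Vec D) : Fn D := fun x => ∑ μ, eta D μ * pd μ (fun y => X y μ) x

/-- Gradient (∂f)_μ = ∂_μ f. -/
def grad {D : ℕ} (f : Fn D) : Vec D := fun x μ => pd μ f x

/-- Wave operator □ = ∂^μ∂_μ on scalars. -/
def box {D : ℕ} (f : Fn D) : Fn D := fun x => ∑ μ, eta D μ * pd μ (pd μ f) x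

/-- Wave operator acting componentwise on vector fields. -/
def boxV {D : ℕ} (X : Vec D) : Vec D := fun x μ => box (fun y => X y μ) x

/-- Generalized Lie derivative product: (X*Y)_μ = X^ν ∂_ν Y_μ + (∂_μ X_ν − ∂_ν X_μ) Y^ν. -/
def starP {D : ℕ} (X Y : Vec D) : Vec D := fun x μ =>
  ∑ ν, eta D ν * (X x ν * pd ν (fun y => Y y μ) x
    + (pd μ (fun y => X y ν) x - pd ν (fun y => X y μ) x) * Y x ν)

/-- Bullet product X•Y = (∂·X)Y − (∂·Y)X + X*Y − Y*X. -/
def bullet {D : ℕ} (X Y : Vec D) : Vec D :=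
  fun x μ => divg X x * Y x μ - divg Y x * X x μ + starP X Y x μ - starP Y X x μ

/-- Pointwise product of scalar fields. -/
def fmul {D : ℕ} (f g : Fn D) : Fn D := fun x => f x * g x

/-- Pointwise scaling of a vector field by a scalar field. -/
def fsmul {D : ℕ} (f : Fn D) (X : Vec D) : Vec D := fun x μ => f x * X x μ

/-- Smoothness of scalar fields. -/
def SmF {D : ℕ} (f : Fn D) : Prop := ContDiff ℝ (⊤ : ℕ∞) f

/-- Smoothness of vector fields. -/
def SmV {D : ℕ} (X : Vec D) : Prop := ∀ μ, ContDiff ℝ (⊤ : ℕ∞) fun x => X x μ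

/-- Differential m₁ : K₀ → K₁, λ ↦ (∂λ, □λ). -/
def m1₀ {D : ℕ} (l : Fn D) : Vec D × Fn D := (grad l, box l)

/-- Differential m₁ : K₁ → K₂, (A,φ) ↦ (□A − ∂φ, ∂·A − φ). -/
def m1₁ {D : ℕ} (a : Vec D × Fn D) : Vec D × Fn D :=
  (fun x μ => boxV a.1 x μ - grad a.2 x μ, fun x => divg a.1 x - a.2 x)

/-- Differential m₁ : K₂ → K₃, (E,e) ↦ □e − ∂·E. -/
def m1₂ {D : ℕ} (e : Vec D × Fn D) : Fn D := fun x => box e.2 x - divg e.1 x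

/-- The degree −1 operator b : K₁ → K₀, b(A,φ) = φ. -/
def b₁ {D : ℕ} (a : Vec D × Fn D) : Fn D := a.2

/-- The degree −1 operator b : K₂ → K₁, b(E,e) = (E, 0). -/
def b₂ {D : ℕ} (e : Vec D × Fn D) : Vec D × Fn D := (e.1, 0)

/-- The degree −1 operator b : K₃ → K₂, b(N) = (0, N). -/
def b₃ {D : ℕ} (N : Fn D) : Vec D × Fn D := (0, N)

namespace SmF

variable {D : ℕ} {f g : Fn D}

lemma differentiable (hf : SmF f) : Differentiable ℝ f :=
  ContDiff.differentiable hf (by simp)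

lemma sub (hf : SmF f) (hg : SmF g) : SmF fun x => f x - g x := ContDiff.sub hf hg

lemma const_mul (c : ℝ) (hf : SmF f) : SmF fun x => c * f x :=
  ContDiff.mul contDiff_const hf

lemma sum {ι : Type*} {s : Finset ι} {F : ι → Fn D} (hF : ∀ i, SmF (F i)) :
    SmF fun x => ∑ i ∈ s, F i x :=
  ContDiff.sum fun i _ => hF i

lemma pd (hf : SmF f) (μ : Fin D) : SmF (pd μ f) :=
  (ContDiff.fderiv_right (m := (⊤ : ℕ∞)) hf (by simp)).clm_apply contDiff_const

lemma box (hf : SmF f) : SmF (box f) :=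
  sum fun μ => const_mul _ ((hf.pd μ).pd μ)

end SmF

section PartialDerivatives

variable {D : ℕ}

lemma SmV.divg {X : Vec D} (hX : SmV X) : SmF (divg X) :=
  SmF.sum fun μ => SmF.const_mul _ (SmF.pd (hX μ) μ)

lemma pd_zero (μ : Fin D) : pd μ (fun _ => 0) = fun _ => 0 := by
  ext x
  simp [pd]

lemma pd_sub {f g : Fn D} (hf : SmF f) (hg : SmF g) (μ : Fin D) :
    pd μ (fun x => f x - g x) = fun x => pd μ f x - pd μ g x := by
  ext x
  simp [pd, fderiv_fun_sub (hf.differentiable x) (hg.differentiable x)]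

lemma pd_const_mul {f : Fn D} (hf : SmF f) (c : ℝ) (μ : Fin D) :
    pd μ (fun x => c * f x) = fun x => c * pd μ f x := by
  ext x
  simp [pd, fderiv_const_mul (hf.differentiable x)]

lemma pd_sum {ι : Type*} {s : Finset ι} {F : ι → Fn D} (hF : ∀ i, SmF (F i)) (μ : Fin D) :
    pd μ (fun x => ∑ i ∈ s, F i x) = fun x => ∑ i ∈ s, pd μ (F i) x := by
  ext x
  simp [pd, fderiv_fun_sum fun i _ => (hF i).differentiable x]

lemma pd_comm {f : Fn D} (hf : SmF f) (μ ν : Fin D) : pd μ (pd ν f) = pd ν (pd μ f) := by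
  ext x
  have hd : DifferentiableAt ℝ (fderiv ℝ f) x :=
    (ContDiff.fderiv_right (m := (⊤ : ℕ∞)) hf (by simp)).differentiable (by simp) x
  have key (α β : Fin D) :
      pd α (pd β f) x = fderiv ℝ (fderiv ℝ f) x (Pi.single α 1) (Pi.single β 1) := by
    unfold pd
    rw [fderiv_clm_apply hd (differentiableAt_const _)]
    simp
  rw [key, key]
  exact (ContDiff.contDiffAt hf).isSymmSndFDerivAt
    (by simpa using WithTop.coe_le_coe.2 (le_top : (2 : ℕ∞) ≤ ⊤)) _ _

lemma pd_box {f : Fn D} (hf : SmF f) (μ : Fin D) : pd μ (box f) = box (pd μ f) := by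
  unfold box
  rw [pd_sum fun ν => SmF.const_mul _ ((hf.pd ν).pd ν)]
  ext x
  refine Finset.sum_congr rfl fun ν _ => ?_
  rw [pd_const_mul ((hf.pd ν).pd ν), pd_comm (hf.pd ν), pd_comm hf μ ν]

lemma box_sub {f g : Fn D} (hf : SmF f) (hg : SmF g) :
    box (fun x => f x - g x) = fun x => box f x - box g x := by
  ext x
  simp only [box, pd_sub hf hg, pd_sub (hf.pd _) (hg.pd _), mul_sub, Finset.sum_sub_distrib]

lemma box_const_mul {f : Fn D} (hf : SmF f) (c : ℝ) :
    box (fun x => c * f x) = fun x => c * box f x := by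
  ext x
  simp only [box, pd_const_mul hf, pd_const_mul (hf.pd _), Finset.mul_sum, mul_left_comm]

lemma box_sum {ι : Type*} {s : Finset ι} {F : ι → Fn D} (hF : ∀ i, SmF (F i)) :
    box (fun x => ∑ i ∈ s, F i x) = fun x => ∑ i ∈ s, box (F i) x := by
  ext x
  simp only [box, pd_sum hF, pd_sum fun i => (hF i).pd _, Finset.mul_sum]
  exact Finset.sum_comm

lemma box_divg {X : Vec D} (hX : SmV X) : box (divg X) = divg (boxV X) := by
  unfold divg
  rw [box_sum fun μ => SmF.const_mul _ (SmF.pd (hX μ) μ)]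
  ext x
  refine Finset.sum_congr rfl fun μ _ => ?_
  rw [box_const_mul (SmF.pd (hX μ) μ), ← pd_box (hX μ)]
  rfl

lemma divg_grad (f : Fn D) : divg (grad f) = box f := rfl

lemma boxV_grad {f : Fn D} (hf : SmF f) : boxV (grad f) = grad (box f) := by
  ext x μ
  exact congrFun (pd_box hf μ).symm x

lemma divg_sub {X Y : Vec D} (hX : SmV X) (hY : SmV Y) :
    divg (fun x μ => X x μ - Y x μ) = fun x => divg X x - divg Y x := by
  ext x
  simp only [divg, pd_sub (hX _) (hY _), mul_sub, Finset.sum_sub_distrib]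

lemma grad_zero : grad (0 : Fn D) = 0 := by
  ext x μ
  exact congrFun (pd_zero μ) x

lemma divg_zero : divg (0 : Vec D) = 0 := by
  ext x
  exact Finset.sum_eq_zero fun μ _ => by simp [pd_zero]

end PartialDerivatives

/-- the Yang–Mills kinematic complex carries a second differential b of
degree −1 realizing the defining relations m₁² = 0, b² = 0 and m₁b + bm₁ = □ of the
BV□ structure.  (b vanishes on K₀, and m₁ vanishes on K₃; the corresponding terms are
written as explicit zeros.) -/
theorem bv_square_defining_relations {D : ℕ} (hD : 1 ≤ D)
    (l : Fn D) (a e : Vec D × Fn D) (N : Fn D)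
    (hl : SmF l) (haV : SmV a.1) (haF : SmF a.2)
    (heV : SmV e.1) (heF : SmF e.2) (hN : SmF N) :
    -- (i)  m₁ ∘ m₁ = 0
    m1₁ (m1₀ l) = 0 ∧
    m1₂ (m1₁ a) = 0 ∧
    -- (ii)  b ∘ b = 0
    b₁ (b₂ e) = 0 ∧
    b₂ (b₃ N) = 0 ∧
    -- (iii)  m₁ b + b m₁ = □
    (0 : Fn D) + b₁ (m1₀ l) = box l ∧
    m1₀ (b₁ a) + b₂ (m1₁ a) = (boxV a.1, box a.2) ∧
    m1₁ (b₂ e) + b₃ (m1₂ e) = (boxV e.1, box e.2) ∧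
    m1₂ (b₃ N) + (0 : Fn D) = box N := by
  refine ⟨?_, ?_, rfl, rfl, zero_add _, ?_, ?_, ?_⟩
  · ext <;> simp [m1₁, m1₀, boxV_grad hl, divg_grad]
  · ext x
    have hdiv := divg_sub (X := boxV a.1) (Y := grad a.2) (fun μ => SmF.box (haV μ)) haF.pd
    simp [m1₂, m1₁, box_sub haV.divg haF, box_divg haV, hdiv, divg_grad]
  · ext <;> simp [m1₀, m1₁, b₁, b₂]
  · ext <;> simp [m1₁, m1₂, b₂, b₃, grad_zero]
  · ext
    simp [m1₂, b₃, divg_zero]
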